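/- Let (X, Y) be a pair of real-valued random variables on a probability space (Ω, 𝔉, P) whose joint law is a centered bivariate Gaussian with covariance matrix Σ satisfying Var(X) = Var(Y) and Var(X − Y) > 0. Then for every u ∈ ℝ: P( X ≥ u, Y ≥ u, X > Y ) = (1/2) · P( X ≤ −u, Y ≤ −u ), i.e., it equals Φ_{0,Σ}(−u, −u)/2 where Φ_{0,Σ} is the cumulative distribution function of the centered bivariate Gaussian with covariance Σ. -/

import Mathlib

open MeasureTheory ProbabilityTheory

/-- A pair `(X, Y)` of real random variables on `(Ω, 𝔉, P)` is a centered bivariate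
Gaussian vector with covariance matrix `Σ = [[vX, cXY], [cXY, vY]]` if every linear
combination `a·X + b·Y` is a real Gaussian with mean `0` and variance
`a² vX + 2ab cXY + b² vY`. -/
def IsCenteredBivariateGaussian {Ω : Type*} [MeasurableSpace Ω] (P : Measure Ω)
    (X Y : Ω → ℝ) (vX cXY vY : ℝ) : Prop :=
  ∀ a b : ℝ,
    Measure.map (fun ω => a * X ω + b * Y ω) P
      = ProbabilityTheory.gaussianReal 0
          (Real.toNNReal (a ^ 2 * vX + 2 * a * b * cXY + b ^ 2 * vY))

/-- Cramér–Wold in the plane: a finite measure is determined by the laws of the linear forms. -/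
theorem measure_prod_ext_of_map_linear {μ ν : Measure (ℝ × ℝ)} [IsFiniteMeasure μ]
    [IsFiniteMeasure ν]
    (h : ∀ a b : ℝ, μ.map (fun p => a * p.1 + b * p.2) = ν.map (fun p => a * p.1 + b * p.2)) :
    μ = ν := by
  refine Measure.ext_of_charFunDual (funext fun L => ?_)
  have hL : (L : ℝ × ℝ → ℝ) = fun p => L (1, 0) * p.1 + L (0, 1) * p.2 := by
    ext p
    have hp : p = p.1 • ((1, 0) : ℝ × ℝ) + p.2 • ((0, 1) : ℝ × ℝ) := by ext <;> simp
    conv_lhs => rw [hp, map_add, map_smul, map_smul]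
    simp [mul_comm]
  rw [charFunDual_eq_charFun_map_one, charFunDual_eq_charFun_map_one, hL, h]

namespace IsCenteredBivariateGaussian

variable {Ω : Type*} [MeasurableSpace Ω] {P : Measure Ω} {X Y : Ω → ℝ} {vX cXY vY : ℝ}

theorem swap (h : IsCenteredBivariateGaussian P X Y vX cXY vY) :
    IsCenteredBivariateGaussian P Y X vY cXY vX := by
  intro a b
  simp_rw [add_comm (a * Y _)]
  rw [h b a]
  congr 2
  ring

theorem neg (h : IsCenteredBivariateGaussian P X Y vX cXY vY) :
    IsCenteredBivariateGaussian P (fun ω => -X ω) (fun ω => -Y ω) vX cXY vY := by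
  intro a b
  simp_rw [mul_neg, ← neg_mul]
  rw [h (-a) (-b)]
  congr 2
  ring

/-- The joint law of a centered bivariate Gaussian vector is determined by its covariance. -/
theorem map_prodMk_eq [IsFiniteMeasure P] {X' Y' : Ω → ℝ}
    (hX : Measurable X) (hY : Measurable Y) (hX' : Measurable X') (hY' : Measurable Y')
    (h : IsCenteredBivariateGaussian P X Y vX cXY vY)
    (h' : IsCenteredBivariateGaussian P X' Y' vX cXY vY) :
    P.map (fun ω => (X ω, Y ω)) = P.map (fun ω => (X' ω, Y' ω)) := by
  refine measure_prod_ext_of_map_linear fun a b => ?_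
  rw [Measure.map_map (by fun_prop) (by fun_prop), Measure.map_map (by fun_prop) (by fun_prop)]
  exact (h a b).trans (h' a b).symm

/-- The components almost surely differ when their difference has positive variance. -/
theorem measure_eq_zero (hX : Measurable X) (hY : Measurable Y)
    (h : IsCenteredBivariateGaussian P X Y vX cXY vY) (hv : 0 < vX + vY - 2 * cXY) :
    P {ω | X ω = Y ω} = 0 := by
  have hne : Real.toNNReal (1 ^ 2 * vX + 2 * 1 * (-1) * cXY + (-1) ^ 2 * vY) ≠ 0 := by
    rw [Ne, Real.toNNReal_eq_zero, not_le]
    linarith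
  have := nullSingletonClass_gaussianReal (μ := 0) hne
  rw [← h 1 (-1)] at this
  have h0 := measure_singleton (μ := P.map fun ω => 1 * X ω + -1 * Y ω) (0 : ℝ)
  rw [Measure.map_apply (by fun_prop) (measurableSet_singleton 0)] at h0
  convert h0 using 2
  ext ω
  simp [← sub_eq_add_neg, sub_eq_zero]

end IsCenteredBivariateGaussian

/-- Let `(X, Y)` be a centered bivariate Gaussian vector with covariance
matrix `Σ` satisfying `Var(X) = Var(Y)` and `Var(X − Y) > 0`. Then for every `u ∈ ℝ`,
`P(X ≥ u, Y ≥ u, X > Y) = Φ_{0,Σ}(−u, −u) / 2`, where `Φ_{0,Σ}(x, y) = P(X ≤ x, Y ≤ y)`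
is the bivariate Gaussian distribution function. -/
theorem gaussian_hitting_scenario_probability
    {Ω : Type*} [MeasurableSpace Ω] (P : Measure Ω) [IsProbabilityMeasure P]
    (X Y : Ω → ℝ) (hX : Measurable X) (hY : Measurable Y)
    (vX cXY vY : ℝ)
    (hGauss : IsCenteredBivariateGaussian P X Y vX cXY vY)
    (hVarEq : vX = vY)
    (hVarDiff : 0 < vX + vY - 2 * cXY) :
    ∀ u : ℝ,
      P {ω | u ≤ X ω ∧ u ≤ Y ω ∧ Y ω < X ω}
        = P {ω | X ω ≤ -u ∧ Y ω ≤ -u} / 2 := by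
  intro u
  subst hVarEq
  have hswap : P {ω | u ≤ X ω ∧ u ≤ Y ω ∧ Y ω < X ω} = P {ω | u ≤ Y ω ∧ u ≤ X ω ∧ X ω < Y ω} := by
    have hS : MeasurableSet {p : ℝ × ℝ | u ≤ p.1 ∧ u ≤ p.2 ∧ p.2 < p.1} := by measurability
    have h := congrArg (· {p : ℝ × ℝ | u ≤ p.1 ∧ u ≤ p.2 ∧ p.2 < p.1})
      (hGauss.map_prodMk_eq hX hY hY hX hGauss.swap)
    simpa [Measure.map_apply (hX.prodMk hY) hS, Measure.map_apply (hY.prodMk hX) hS] using h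
  have hneg : P {ω | X ω ≤ -u ∧ Y ω ≤ -u} = P {ω | u ≤ X ω ∧ u ≤ Y ω} := by
    have hS : MeasurableSet {p : ℝ × ℝ | p.1 ≤ -u ∧ p.2 ≤ -u} := by measurability
    have h := congrArg (· {p : ℝ × ℝ | p.1 ≤ -u ∧ p.2 ≤ -u})
      (hGauss.map_prodMk_eq hX hY hX.fun_neg hY.fun_neg hGauss.neg)
    simpa [Measure.map_apply (hX.prodMk hY) hS,
      Measure.map_apply (hX.fun_neg.prodMk hY.fun_neg) hS] using h
  have hsplit : P {ω | u ≤ X ω ∧ u ≤ Y ω} =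
      P {ω | u ≤ X ω ∧ u ≤ Y ω ∧ Y ω < X ω} + P {ω | u ≤ Y ω ∧ u ≤ X ω ∧ X ω < Y ω} := by
    rw [← measure_union]
    · have hae : ∀ᵐ ω ∂P, X ω ≠ Y ω := by
        simpa [ae_iff] using hGauss.measure_eq_zero hX hY hVarDiff
      refine measure_congr ?_
      filter_upwards [hae] with ω hω
      refine propext (show (u ≤ X ω ∧ u ≤ Y ω) ↔
        (u ≤ X ω ∧ u ≤ Y ω ∧ Y ω < X ω) ∨ (u ≤ Y ω ∧ u ≤ X ω ∧ X ω < Y ω) from ?_)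
      have := lt_or_gt_of_ne hω
      tauto
    · exact Set.disjoint_left.2 fun ω h h' => lt_asymm h.2.2 h'.2.2
    · exact (measurableSet_le measurable_const hY).inter
        ((measurableSet_le measurable_const hX).inter (measurableSet_lt hX hY))
  rw [hneg, hsplit, ← hswap, ENNReal.add_div, ENNReal.add_halves]
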